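/- Assume the continuum hypothesis (2^{ℵ₀} = ℵ₁). Then every infinite-dimensional factor N acting on a separable Hilbert space admits 2^{ℵ₁} distinct pure states that are not classically normal. -/

import Mathlib

open scoped ComplexOrder InnerProductSpace
open Filter Topology

noncomputable instance {H : Type*} [NormedAddCommGroup H] [InnerProductSpace ℂ H]
    [CompleteSpace H] : SMulMemClass (VonNeumannAlgebra H) ℂ (H →L[ℂ] H) :=
  ⟨fun {s} c {_} hx => s.toStarSubalgebra.smul_mem hx c⟩

/-- The σ-weak (ultraweak, weak*) topology on `B(H)`: the initial topology induced by the
functionals `x ↦ ∑' n, ⟪ξ n, x (η n)⟫` over all pairs of square-summable sequences. -/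
noncomputable def sigmaWeak (H : Type*) [NormedAddCommGroup H] [InnerProductSpace ℂ H]
    [CompleteSpace H] : TopologicalSpace (H →L[ℂ] H) :=
  ⨅ (ξ : ℕ → H) (η : ℕ → H) (_ : Summable fun n => ‖ξ n‖ ^ 2)
    (_ : Summable fun n => ‖η n‖ ^ 2),
    TopologicalSpace.induced (fun x : H →L[ℂ] H => ∑' n, ⟪ξ n, x (η n)⟫_ℂ) inferInstance

variable {H : Type*} [NormedAddCommGroup H] [InnerProductSpace ℂ H] [CompleteSpace H]

/-- A positive linear functional on a von Neumann algebra. -/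
def IsPosFunctional (M : VonNeumannAlgebra H) (f : ↥M →ₗ[ℂ] ℂ) : Prop :=
  ∀ a : ↥M, 0 ≤ f (star a * a)

/-- A state on a von Neumann algebra: a positive linear functional sending `1` to `1`. -/
def IsStateOn (M : VonNeumannAlgebra H) (f : ↥M →ₗ[ℂ] ℂ) : Prop :=
  IsPosFunctional M f ∧ f 1 = 1

/-- A pure state: a state such that every positive linear functional it dominates is a
nonnegative scalar multiple of it. -/
def IsPureStateOn (M : VonNeumannAlgebra H) (f : ↥M →ₗ[ℂ] ℂ) : Prop :=
  IsStateOn M f ∧ ∀ g : ↥M →ₗ[ℂ] ℂ, IsPosFunctional M g → IsPosFunctional M (f - g) →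
    ∃ t : ℝ, 0 ≤ t ∧ g = (t : ℂ) • f

/-- A functional on a von Neumann algebra is normal if it is continuous for the σ-weak
topology. -/
def IsNormalOn (M : VonNeumannAlgebra H) (f : ↥M →ₗ[ℂ] ℂ) : Prop :=
  @Continuous ↥M ℂ
    (TopologicalSpace.induced (fun x : ↥M => (x : H →L[ℂ] H)) (sigmaWeak H)) _ f

/-- A state on a von Neumann algebra is singular if the only normal positive linear
functional it dominates is `0`. -/
def IsSingularOn (M : VonNeumannAlgebra H) (f : ↥M →ₗ[ℂ] ℂ) : Prop :=
  ∀ g : ↥M →ₗ[ℂ] ℂ, IsPosFunctional M g → IsPosFunctional M (f - g) → IsNormalOn M g → g = 0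

/-- A projection: a self-adjoint idempotent. -/
def IsProjection (p : H →L[ℂ] H) : Prop := star p = p ∧ p * p = p

/-- `q` is a subprojection of `p` (i.e. `q ≤ p` for projections). -/
def ProjLE (q p : H →L[ℂ] H) : Prop := q * p = q ∧ p * q = q

/-- `p` is a minimal projection of the set `S`: a nonzero projection in `S` such that the
only projections of `S` below `p` are `0` and `p`. -/
def IsMinimalProjectionIn (S : Set (H →L[ℂ] H)) (p : H →L[ℂ] H) : Prop :=
  p ∈ S ∧ IsProjection p ∧ p ≠ 0 ∧
    ∀ q ∈ S, IsProjection q → ProjLE q p → q = 0 ∨ q = p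

/-- `f` is multiplicative on the subset `C` of `M`. -/
def IsMultiplicativeOn (M : VonNeumannAlgebra H) (f : ↥M →ₗ[ℂ] ℂ)
    (C : Set (H →L[ℂ] H)) : Prop :=
  ∀ a b : ↥M, (a : H →L[ℂ] H) ∈ C → (b : H →L[ℂ] H) ∈ C → f (a * b) = f a * f b

/-- `f` is normal on the von Neumann subalgebra `C` of `M` (where `C ⊆ M`): the restriction
of `f` to `C` is σ-weakly continuous. -/
def IsNormalOnSub (M : VonNeumannAlgebra H) (f : ↥M →ₗ[ℂ] ℂ) (C : VonNeumannAlgebra H)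
    (hC : (C : Set (H →L[ℂ] H)) ⊆ M) : Prop :=
  @Continuous ↥C ℂ
    (TopologicalSpace.induced (fun x : ↥C => (x : H →L[ℂ] H)) (sigmaWeak H)) _
    (fun x => f ⟨x, hC x.2⟩)

/-- A state on `M` is classically normal if it is normal on every von Neumann subalgebra
of `M` (with the same unit) on which it is multiplicative. -/
def IsClassicallyNormalOn (M : VonNeumannAlgebra H) (f : ↥M →ₗ[ℂ] ℂ) : Prop :=
  ∀ (C : VonNeumannAlgebra H) (hC : (C : Set (H →L[ℂ] H)) ⊆ M),
    IsMultiplicativeOn M f (C : Set (H →L[ℂ] H)) → IsNormalOnSub M f C hC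

/-- A von Neumann algebra is a factor if its center consists of the scalar multiples of
the identity. -/
def IsFactor (N : VonNeumannAlgebra H) : Prop :=
  ∀ x ∈ N, (∀ y ∈ N, x * y = y * x) → ∃ c : ℂ, x = c • (1 : H →L[ℂ] H)

/-- A positive operator on a Hilbert space. -/
def IsPositiveOp (a : H →L[ℂ] H) : Prop :=
  star a = a ∧ ∀ v : H, 0 ≤ ⟪v, a v⟫_ℂ


section OrthogonalSequence

/-- The projection onto the closure of a subspace that is invariant under the commutant of a
von Neumann algebra belongs to that algebra. -/
theorem starProjection_closure_mem (N : VonNeumannAlgebra H) (K : Submodule ℂ H)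
    (hK : ∀ y ∈ N.commutant, ∀ v ∈ K, y v ∈ K) : K.topologicalClosure.starProjection ∈ N := by
  rw [VonNeumannAlgebra.IsStarProjection.mem_iff isStarProjection_starProjection]
  intro y hy
  rw [Submodule.range_starProjection, Module.End.mem_invtSubmodule]
  intro v hv
  exact map_mem_closure (s := (K : Set H)) (t := (K : Set H)) y.continuous hv fun w hw => hK y hy w hw

/-- The range projection of an element of a von Neumann algebra. -/
theorem exists_rangeProjection (N : VonNeumannAlgebra H) {x : H →L[ℂ] H} (hx : x ∈ N) :
    ∃ p ∈ N, IsStarProjection p ∧ p * x = x ∧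
      (∀ e, e * x = x → e * p = p) ∧ ∀ y, star x * y = 0 → p * y = 0 := by
  set K := (LinearMap.range (x : H →ₗ[ℂ] H)) with hKdef
  refine ⟨K.topologicalClosure.starProjection, starProjection_closure_mem N K ?_,
    isStarProjection_starProjection, ?_, ?_, ?_⟩
  · rintro y hy _ ⟨v, rfl⟩
    exact ⟨y v, congr($(VonNeumannAlgebra.mem_commutant_iff.1 hy x hx) v)⟩
  · ext v
    exact Submodule.starProjection_eq_self_iff.2 (K.le_topologicalClosure ⟨v, rfl⟩)
  · intro e he
    have key : ∀ w ∈ K.topologicalClosure, e w = w := by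
      intro w hw
      refine closure_minimal (s := (K : Set H)) (t := {w | e w = w}) ?_
        (isClosed_eq e.continuous continuous_id) hw
      rintro _ ⟨v, rfl⟩
      exact congr($he v)
    ext v
    exact key _ (Submodule.starProjection_apply_mem _ v)
  · intro y hy
    ext v
    refine (Submodule.starProjection_apply_eq_zero_iff _).2 ?_
    rw [Submodule.orthogonal_closure]
    rintro _ ⟨w, rfl⟩
    have h := congr($hy v)
    simp only [mul_apply_eq_comp, zero_apply,
      ContinuousLinearMap.star_eq_adjoint] at h
    simp [← ContinuousLinearMap.adjoint_inner_right, h]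

/-- Continuous functional calculus on self-adjoint elements does not leave a von Neumann
algebra. -/
theorem cfcₙ_real_mem (N : VonNeumannAlgebra H) {a : H →L[ℂ] H} (ha : a ∈ N) (f : ℝ → ℝ) :
    cfcₙ f a ∈ N := by
  rw [← N.commutant_commutant, VonNeumannAlgebra.mem_commutant_iff]
  intro g hg
  have : Commute a g := VonNeumannAlgebra.mem_commutant_iff.1 hg a ha
  exact (this.cfcₙ_real f).eq.symm

theorem cfcₙ_nnreal_mem (N : VonNeumannAlgebra H) {a : H →L[ℂ] H} (ha : a ∈ N)
    (f : NNReal → NNReal) : cfcₙ f a ∈ N := by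
  rw [← N.commutant_commutant, VonNeumannAlgebra.mem_commutant_iff]
  intro g hg
  have : Commute a g := VonNeumannAlgebra.mem_commutant_iff.1 hg a ha
  exact (this.cfcₙ_nnreal f).eq.symm

/-- A left unit of `b` is a left unit of any self-adjoint `c` with `c ^ 2 = b * c`. -/
theorem mul_eq_self_of_mul_self_eq {e b c : H →L[ℂ] H} (hc : IsSelfAdjoint c)
    (hcc : c * c = b * c) (hb : e * b = b) : e * c = c := by
  have h0 : (1 - e) * c = 0 := by
    rw [← CStarRing.mul_star_self_eq_zero_iff, star_mul, hc.star_eq, mul_assoc,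
      ← mul_assoc c c, hcc, ← mul_assoc, ← mul_assoc, sub_mul, one_mul, hb, sub_self,
      zero_mul, zero_mul]
  rw [sub_mul, one_mul, sub_eq_zero] at h0
  exact h0.symm

theorem nonpos_or_nonneg_of_no_zero_divisors (N : VonNeumannAlgebra H) {e : H →L[ℂ] H}
    (hmin : ∀ x ∈ N, ∀ y ∈ N, IsSelfAdjoint x → IsSelfAdjoint y → e * x = x → e * y = y →
      x * y = 0 → x = 0 ∨ y = 0)
    {b : H →L[ℂ] H} (hbN : b ∈ N) (hbsa : IsSelfAdjoint b) (heb : e * b = b) :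
    b ≤ 0 ∨ 0 ≤ b := by
  have hsub := CFC.posPart_sub_negPart b hbsa
  have hp : IsSelfAdjoint b⁺ := (CFC.posPart_nonneg b).isSelfAdjoint
  have hn : IsSelfAdjoint b⁻ := (CFC.negPart_nonneg b).isSelfAdjoint
  have hpp : b⁺ * b⁺ = b * b⁺ := by
    calc b⁺ * b⁺ = (b⁺ - b⁻) * b⁺ := by rw [sub_mul, CFC.negPart_mul_posPart, sub_zero]
      _ = b * b⁺ := by rw [hsub]
  have hnn : b⁻ * b⁻ = -b * b⁻ := by
    calc b⁻ * b⁻ = -(b⁺ - b⁻) * b⁻ := by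
          rw [neg_sub, sub_mul, CFC.posPart_mul_negPart, sub_zero]
      _ = -b * b⁻ := by rw [hsub]
  have h1 : e * b⁺ = b⁺ := mul_eq_self_of_mul_self_eq hp hpp heb
  have h2 : e * b⁻ = b⁻ := mul_eq_self_of_mul_self_eq hn hnn (by rw [mul_neg, heb])
  have hpN : b⁺ ∈ N := by rw [CFC.posPart_def]; exact cfcₙ_real_mem N hbN _
  have hnN : b⁻ ∈ N := by rw [CFC.negPart_def]; exact cfcₙ_real_mem N hbN _
  rcases hmin _ hpN _ hnN hp hn h1 h2 (CFC.posPart_mul_negPart b) with h | h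
  · left; exact (CFC.posPart_eq_zero_iff b hbsa).1 h
  · right; exact (CFC.negPart_eq_zero_iff b hbsa).1 h

/-- If the corner `eNe` has no self-adjoint zero divisors, its self-adjoint elements are
scalar. -/
theorem exists_real_smul_of_no_zero_divisors (N : VonNeumannAlgebra H) {e : H →L[ℂ] H}
    (heN : e ∈ N) (he : IsStarProjection e)
    (hmin : ∀ x ∈ N, ∀ y ∈ N, IsSelfAdjoint x → IsSelfAdjoint y → e * x = x → e * y = y →
      x * y = 0 → x = 0 ∨ y = 0)
    {a : H →L[ℂ] H} (ha : a ∈ N) (hsa : IsSelfAdjoint a) (hea : e * a = a) :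
    ∃ t : ℂ, a = t • e := by
  have hee : star e = e := he.isSelfAdjoint.star_eq
  have hae : a * e = a := by simpa [hsa.star_eq, hee] using congr(star $hea)
  have dich : ∀ t : ℝ, a - (t : ℂ) • e ≤ 0 ∨ 0 ≤ a - (t : ℂ) • e := by
    intro t
    have hte : IsSelfAdjoint ((t : ℂ) • e) := by
      rw [isSelfAdjoint_iff, star_smul, hee, Complex.star_def, Complex.conj_ofReal]
    exact nonpos_or_nonneg_of_no_zero_divisors N hmin
      (sub_mem ha (SMulMemClass.smul_mem _ heN)) (hsa.sub hte)
      (by rw [mul_sub, hea, mul_smul_comm, he.isIdempotentElem.eq])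
  have hcont : Continuous fun t : ℝ => a - (t : ℂ) • e := by fun_prop
  have hc1 : IsClosed {t : ℝ | a - (t : ℂ) • e ≤ 0} := isClosed_le hcont continuous_const
  have hc2 : IsClosed {t : ℝ | 0 ≤ a - (t : ℂ) • e} := isClosed_le continuous_const hcont
  have bound : ∀ b : H →L[ℂ] H, IsSelfAdjoint b → e * b = b → b * e = b → b ≤ (‖b‖ : ℂ) • e := by
    intro b hb h1 h2
    have h3 : b ≤ (‖b‖ : ℂ) • (1 : H →L[ℂ] H) := by
      refine hb.le_algebraMap_norm_self.trans_eq ?_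
      ext; simp [Algebra.algebraMap_eq_smul_one]
    have h4 := star_left_conjugate_le_conjugate h3 e
    rwa [hee, h1, h2, mul_smul_comm, smul_mul_assoc, mul_one, he.isIdempotentElem.eq] at h4
  have hn1 : ‖a‖ ∈ {t : ℝ | a - (t : ℂ) • e ≤ 0} := sub_nonpos.2 (bound a hsa hea hae)
  have hn2 : -‖a‖ ∈ {t : ℝ | 0 ≤ a - (t : ℂ) • e} := by
    have := bound (-a) hsa.neg (by simp [hea]) (by simp [hae])
    rw [norm_neg] at this
    have h3 : a - ((-‖a‖ : ℝ) : ℂ) • e = (‖a‖ : ℂ) • e - -a := by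
      rw [Complex.ofReal_neg, neg_smul]; abel
    rw [Set.mem_ofPred_eq, h3]
    exact sub_nonneg.2 this
  obtain ⟨t, -, h1, h2⟩ := isPreconnected_closed_iff.1 (isPreconnected_univ (α := ℝ)) _ _ hc1 hc2
    (fun t _ => dich t) ⟨_, trivial, hn1⟩ ⟨_, trivial, hn2⟩
  exact ⟨t, sub_eq_zero.1 (le_antisymm h1 h2)⟩

/-- The right ideal `eN` generated by `e`. -/
noncomputable def rightIdeal (N : VonNeumannAlgebra H) (e : H →L[ℂ] H) :
    Submodule ℂ (H →L[ℂ] H) :=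
  (Subalgebra.toSubmodule N.toStarSubalgebra.toSubalgebra).map (LinearMap.mulLeft ℂ e)

theorem rightIdeal_add_le (N : VonNeumannAlgebra H) (f g : H →L[ℂ] H) :
    rightIdeal N (f + g) ≤ rightIdeal N f ⊔ rightIdeal N g := by
  rintro _ ⟨y, hy, rfl⟩
  exact Submodule.mem_sup.2 ⟨f * y, ⟨y, hy, rfl⟩, g * y, ⟨y, hy, rfl⟩, (add_mul f g y).symm⟩

/-- A projection `e` with `eN` infinite-dimensional and `eNe` without zero divisors gives an
orthogonal sequence in `N`. -/
theorem exists_orthogonal_seq_of_no_zero_divisors (N : VonNeumannAlgebra H) {e : H →L[ℂ] H}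
    (heN : e ∈ N) (he : IsStarProjection e)
    (hmin : ∀ x ∈ N, ∀ y ∈ N, IsSelfAdjoint x → IsSelfAdjoint y → e * x = x → e * y = y →
      x * y = 0 → x = 0 ∨ y = 0)
    (hinf : ¬ FiniteDimensional ℂ (rightIdeal N e)) :
    ∃ T : ℕ → (H →L[ℂ] H), (∀ n, T n ∈ N ∧ T n ≠ 0) ∧ ∀ m n, m ≠ n → star (T m) * T n = 0 := by
  have hee : star e = e := he.isSelfAdjoint.star_eq
  have hmul : ∀ x ∈ rightIdeal N e, e * x = x := by
    rintro _ ⟨y, -, rfl⟩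
    simp [← mul_assoc, he.isIdempotentElem.eq]
  have hmem : ∀ x ∈ rightIdeal N e, x ∈ N := by
    rintro _ ⟨y, hy, rfl⟩
    exact mul_mem heN hy
  have hscal : ∀ z ∈ N, e * z = z → z * e = z → ∃ t : ℂ, z = t • e := by
    intro z hz h1 h2
    have h3 : e * star z = star z := by simpa [hee] using congr(star $h2)
    have hre := exists_real_smul_of_no_zero_divisors N heN he hmin (a := z + star z)
      (add_mem hz (star_mem hz)) (IsSelfAdjoint.add_star_self z) (by rw [mul_add, h1, h3])
    have him := exists_real_smul_of_no_zero_divisors N heN he hmin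
      (a := Complex.I • (z - star z))
      (SMulMemClass.smul_mem _ (sub_mem hz (star_mem hz)))
      (by rw [isSelfAdjoint_iff, star_smul, star_sub, star_star, Complex.star_def,
            Complex.conj_I, neg_smul, ← smul_neg, neg_sub])
      (by rw [mul_smul_comm, mul_sub, h1, h3])
    obtain ⟨s, hs⟩ := hre
    obtain ⟨t, ht⟩ := him
    have ht' : z - star z = (-Complex.I * t) • e := by
      rw [mul_smul, ← ht, smul_smul]; simp
    refine ⟨(s + -Complex.I * t) / 2, ?_⟩
    have h4 : (2 : ℂ) • z = (s + -Complex.I * t) • e := by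
      rw [add_smul, ← hs, ← ht', two_smul]; abel
    rw [div_eq_inv_mul, mul_smul, ← h4, smul_smul]; simp
  have hsymm : Std.Symm fun x y : H →L[ℂ] H => x * star y = 0 :=
    ⟨fun x y h => by simpa using congr(star $h)⟩
  have hstep : ∀ s : Finset (H →L[ℂ] H), (∀ x ∈ s, x ∈ rightIdeal N e ∧ x ≠ 0) →
      ∃ y, (y ∈ rightIdeal N e ∧ y ≠ 0) ∧ ∀ x ∈ s, x * star y = 0 := by
    intro s hs
    have hspan : ∀ (x : s) (y : rightIdeal N e),
        y.1 * star x.1 ∈ Submodule.span ℂ {e} := by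
      intro x y
      have hx := (hs x.1 x.2).1
      obtain ⟨t, ht⟩ := hscal (y.1 * star x.1) (mul_mem (hmem _ y.2) (star_mem (hmem _ hx)))
        (by rw [← mul_assoc, hmul _ y.2])
        (by
          have : star x.1 * e = star x.1 := by simpa [hee] using congr(star $(hmul _ hx))
          rw [mul_assoc, this])
      exact Submodule.mem_span_singleton.2 ⟨t, ht.symm⟩
    let Φ : rightIdeal N e →ₗ[ℂ] (s → Submodule.span ℂ {e}) :=
      LinearMap.pi fun x =>
        ((LinearMap.mulRight ℂ (star x.1)).domRestrict (rightIdeal N e)).codRestrict _ (hspan x)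
    have hΦ : ¬ Function.Injective Φ := fun h => hinf (FiniteDimensional.of_injective Φ h)
    rw [← LinearMap.ker_eq_bot, Submodule.eq_bot_iff] at hΦ
    push Not at hΦ
    obtain ⟨y, hy, hy0⟩ := hΦ
    refine ⟨y.1, ⟨y.2, fun h => hy0 (Subtype.ext h)⟩, fun x hx => ?_⟩
    have h0 : y.1 * star x = 0 := congrArg Subtype.val (congrFun (LinearMap.mem_ker.1 hy) ⟨x, hx⟩)
    simpa using congr(star $h0)
  obtain ⟨T, hT, hTT⟩ := exists_seq_of_forall_finset_exists'
    (fun x : H →L[ℂ] H => x ∈ rightIdeal N e ∧ x ≠ 0) (fun x y => x * star y = 0)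
    hstep
  exact ⟨fun n => star (T n), fun n => ⟨star_mem (hmem _ (hT n).1), star_ne_zero.2 (hT n).2⟩,
      fun m n hmn => by rw [star_star]; exact hTT hmn⟩

theorem exists_orthogonal_seq (N : VonNeumannAlgebra H) (hinf : ¬ FiniteDimensional ℂ ↥N) :
    ∃ T : ℕ → (H →L[ℂ] H), (∀ n, T n ∈ N ∧ T n ≠ 0) ∧ ∀ m n, m ≠ n → star (T m) * T n = 0 := by
  by_cases hcase : ∃ e ∈ N, IsStarProjection e ∧ ¬ FiniteDimensional ℂ (rightIdeal N e) ∧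
    ∀ x ∈ N, ∀ y ∈ N, IsSelfAdjoint x → IsSelfAdjoint y → e * x = x → e * y = y →
      x * y = 0 → x = 0 ∨ y = 0
  · obtain ⟨e, heN, he, hdim, hmin⟩ := hcase
    exact exists_orthogonal_seq_of_no_zero_divisors N heN he hmin hdim
  · push Not at hcase
    let P : Type _ := {e : H →L[ℂ] H //
      e ∈ N ∧ IsStarProjection e ∧ ¬ FiniteDimensional ℂ (rightIdeal N e)}
    have hstep : ∀ e : P, ∃ e' : P, e.1 * e'.1 = e'.1 ∧ e'.1 ≠ e.1 := by
      rintro ⟨e, heN, he, hdim⟩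
      obtain ⟨x, hx, y, hy, hxs, hys, hex, hey, hxy, hx0, hy0⟩ := hcase e heN he hdim
      obtain ⟨p, hpN, hp, hpx, hpe, hpy⟩ := exists_rangeProjection N hx
      have hep := hpe e hex
      have hpy0 : p * y = 0 := hpy y (by rwa [hxs.star_eq])
      have hpe' : p * e = p := by
        simpa [hp.isSelfAdjoint.star_eq, he.isSelfAdjoint.star_eq] using congr(star $hep)
      have hq : IsStarProjection (e - p) := by
        constructor
        · simp only [IsIdempotentElem, mul_sub, sub_mul, hep, hpe', he.isIdempotentElem.eq,
            hp.isIdempotentElem.eq]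
          abel
        · exact he.isSelfAdjoint.sub hp.isSelfAdjoint
      have hor : ¬ FiniteDimensional ℂ (rightIdeal N p) ∨
          ¬ FiniteDimensional ℂ (rightIdeal N (e - p)) := by
        by_contra! hcon
        obtain ⟨_, _⟩ := hcon
        refine hdim ?_
        have := rightIdeal_add_le N p (e - p)
        rw [add_sub_cancel] at this
        exact Submodule.finiteDimensional_of_le this
      rcases hor with h | h
      · refine ⟨⟨p, hpN, hp, h⟩, hep, ?_⟩
        rintro rfl
        exact hy0 (hey.symm.trans hpy0)
      · refine ⟨⟨e - p, sub_mem heN hpN, hq, h⟩, ?_, ?_⟩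
        · simp [mul_sub, he.isIdempotentElem.eq, hep]
        · intro h0
          have : p = 0 := by simpa using h0
          rw [this, zero_mul] at hpx
          exact hx0 hpx.symm
    have hone : ¬ FiniteDimensional ℂ (rightIdeal N 1) := by
      intro h
      let j : ↥N →ₗ[ℂ] rightIdeal N 1 :=
        { toFun := fun x => ⟨x.1, x.1, x.2, one_mul x.1⟩
          map_add' := fun _ _ => rfl
          map_smul' := fun _ _ => rfl }
      exact hinf (FiniteDimensional.of_injective j fun x y hxy =>
        Subtype.ext (congrArg (fun z => z.1) hxy))
    choose next hnext hne using hstep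
    let E : ℕ → P := fun n => next^[n] ⟨1, one_mem N, .one _, hone⟩
    have hE : ∀ n, E (n + 1) = next (E n) := fun n => Function.iterate_succ_apply' _ _ _
    have hmul : ∀ m k, (E m).1 * (E (m + k)).1 = (E (m + k)).1 := by
      intro m k
      induction k with
      | zero => exact (E m).2.2.1.isIdempotentElem.eq
      | succ k ih =>
        rw [← add_assoc, hE, ← hnext, ← mul_assoc, ih]
    have hmul' : ∀ m n, m ≤ n → (E m).1 * (E n).1 = (E n).1 := by
      intro m n h
      obtain ⟨k, rfl⟩ := Nat.exists_eq_add_of_le h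
      exact hmul m k
    have hsa : ∀ n, star (E n).1 = (E n).1 := fun n => (E n).2.2.1.isSelfAdjoint.star_eq
    have hmul'' : ∀ m n, m ≤ n → (E n).1 * (E m).1 = (E n).1 := by
      intro m n h
      simpa [hsa] using congr(star $(hmul' m n h))
    refine ⟨fun n => (E n).1 - (E (n + 1)).1,
      fun n => ⟨sub_mem (E n).2.1 (E (n + 1)).2.1, ?_⟩, ?_⟩
    · rw [sub_ne_zero, hE]
      exact (hne (E n)).symm
    · intro m n hmn
      simp only [star_sub, hsa, mul_sub, sub_mul]
      rcases lt_or_gt_of_ne hmn with h | h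
      · rw [hmul' m n h.le, hmul' (m + 1) n h, hmul' m (n + 1) (by omega),
          hmul' (m + 1) (n + 1) (by omega)]
        abel
      · rw [hmul'' n m h.le, hmul'' n (m + 1) (by omega), hmul'' (n + 1) m h,
          hmul'' (n + 1) (m + 1) (by omega)]
        abel

end OrthogonalSequence

section PositiveFunctionals

variable {M : VonNeumannAlgebra H} {f : ↥M →ₗ[ℂ] ℂ}

theorem IsPosFunctional.map_star_mul (hf : IsPosFunctional M f) (a b : ↥M) :
    f (star b * a) = (starRingEnd ℂ) (f (star a * b)) := by
  have him : ∀ c : ↥M, (f (star c * c)).im = 0 := fun c => ((Complex.nonneg_iff.1 (hf c)).2).symm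
  have h1 := him (a + b)
  have h2 := him (a + Complex.I • b)
  have ha := him a
  have hb := him b
  simp only [star_add, star_smul, add_mul, mul_add, map_add, smul_mul_assoc, mul_smul_comm,
    map_smul, Complex.add_im, ha, hb, smul_eq_mul, Complex.star_def, Complex.conj_I,
    Complex.mul_im, Complex.mul_re, Complex.neg_re, Complex.neg_im, Complex.I_re,
    Complex.I_im] at h1 h2
  apply Complex.ext
  · simp only [Complex.conj_re]; linarith
  · simp only [Complex.conj_im]; linarith

theorem IsPosFunctional.cauchy_schwarz (hf : IsPosFunctional M f) (a b : ↥M) :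
    ‖f (star a * b)‖ ^ 2 ≤ (f (star a * a)).re * (f (star b * b)).re := by
  let c : PreInnerProductSpace.Core ℂ ↥M :=
    { inner := fun x y => f (star x * y)
      conj_inner_symm := fun x y => (hf.map_star_mul y x).symm
      re_inner_nonneg := fun x => (Complex.nonneg_iff.1 (hf x)).1
      add_left := fun x y z => by simp [add_mul]
      smul_left := fun x y r => by simp }
  have := @InnerProductSpace.Core.inner_mul_inner_self_le ℂ ↥M _ _ _ c a b
  change ‖f (star a * b)‖ * ‖f (star b * a)‖ ≤ (f (star a * a)).re * (f (star b * b)).re at this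
  rwa [hf.map_star_mul a b, Complex.norm_conj, ← sq] at this

theorem IsPosFunctional.map_mul_eq_zero (hf : IsPosFunctional M f) {b : ↥M}
    (hb : f (star b * b) = 0) (a : ↥M) : f (a * b) = 0 := by
  have := hf.cauchy_schwarz (star a) b
  rw [hb, star_star, Complex.zero_re, mul_zero] at this
  exact norm_eq_zero.1 (pow_eq_zero_iff two_ne_zero |>.1 (le_antisymm this (sq_nonneg _)))

theorem IsPosFunctional.eq_zero (hf : IsPosFunctional M f) (h1 : f 1 = 0) : f = 0 := by
  ext a
  simpa using hf.map_mul_eq_zero (b := 1) (by simpa using h1) a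

/-- A positive element of a von Neumann algebra has a square root in the algebra. -/
theorem exists_star_mul_self_eq (M : VonNeumannAlgebra H) {a : H →L[ℂ] H} (ha : a ∈ M)
    (h0 : 0 ≤ a) : ∃ b ∈ M, star b * b = a := by
  refine ⟨CFC.sqrt a, ?_, ?_⟩
  · exact cfcₙ_nnreal_mem M ha _
  · rw [(CFC.sqrt_nonneg a).isSelfAdjoint.star_eq, CFC.sqrt_mul_sqrt_self a]

theorem IsStateOn.norm_apply_le (hf : IsStateOn M f) (a : ↥M) :
    ‖f a‖ ≤ ‖(a : H →L[ℂ] H)‖ := by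
  obtain ⟨hf, h1⟩ := hf
  have hcs := hf.cauchy_schwarz 1 a
  simp only [star_one, one_mul, h1, Complex.one_re] at hcs
  set r : ℝ := ‖(a : H →L[ℂ] H)‖ with hr
  have hle : (0 : H →L[ℂ] H) ≤ ((r ^ 2 : ℝ) : ℂ) • (1 : H →L[ℂ] H) - star (a : H →L[ℂ] H) * a := by
    rw [sub_nonneg]
    refine (IsSelfAdjoint.star_mul_self (a : H →L[ℂ] H)).le_algebraMap_norm_self.trans_eq ?_
    rw [CStarRing.norm_star_mul_self, ← sq, ← hr]
    generalize r ^ 2 = q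
    ext; simp [Algebra.algebraMap_eq_smul_one]
  obtain ⟨b, hbM, hb⟩ := exists_star_mul_self_eq M (sub_mem
    (SMulMemClass.smul_mem _ (one_mem M)) (mul_mem (star_mem a.2) a.2)) hle
  have hb' : star (⟨b, hbM⟩ : ↥M) * ⟨b, hbM⟩ = ((r ^ 2 : ℝ) : ℂ) • (1 : ↥M) - star a * a :=
    Subtype.ext hb
  have hpos := hf ⟨b, hbM⟩
  rw [hb', map_sub, map_smul, h1, smul_eq_mul, mul_one] at hpos
  have hre := (Complex.nonneg_iff.1 hpos).1
  rw [Complex.sub_re, Complex.ofReal_re] at hre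
  exact abs_le_of_sq_le_sq' (by linarith) (norm_nonneg _) |>.2

end PositiveFunctionals

section Ultrafilters

/-- The sets of the standard independent family on `Finset ℕ × Finset (Finset ℕ)`. -/
def independentSet (A : Set ℕ) : Set (Finset ℕ × Finset (Finset ℕ)) :=
  open Classical in {x | x.1.filter (· ∈ A) ∈ x.2}

/-- There are `2 ^ 2 ^ ℵ₀` free ultrafilters on `ℕ`. -/
theorem exists_injective_free_ultrafilters :
    ∃ U : Set (Set ℕ) → Ultrafilter ℕ, Function.Injective U ∧ ∀ T, (U T : Filter ℕ) ≤ cofinite := by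
  classical
  let X := Finset ℕ × Finset (Finset ℕ)
  let B : Set (Set ℕ) → Set ℕ → Set X := fun T A =>
    if A ∈ T then independentSet A else (independentSet A)ᶜ
  let F : Set (Set ℕ) → Filter X := fun T => (⨅ A, 𝓟 (B T A)) ⊓ cofinite
  have hF : ∀ T, (F T).NeBot := by
    intro T
    refine ((hasBasis_iInf_principal_finite (B T)).inf_neBot_iff).2 ?_
    intro t ht s hs
    let x : ℕ → X := fun n =>
      (Finset.range n, (ht.toFinset.filter (· ∈ T)).image fun A => (Finset.range n).filter (· ∈ A))
    have hx : Function.Injective x := fun m n h =>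
      by simpa [x] using congrArg (fun y => y.1.card) h
    have hxs : ∀ᶠ n in atTop, x n ∈ s := by
      have := hx.tendsto_cofinite
      rw [Nat.cofinite_eq_atTop] at this
      exact this.eventually_mem hs
    have hsep : ∀ᶠ n in atTop, ∀ A ∈ t, ∀ A' ∈ t,
        (Finset.range n).filter (· ∈ A) = (Finset.range n).filter (· ∈ A') → A = A' := by
      refine (eventually_all_finite ht).2 fun A _ => (eventually_all_finite ht).2 fun A' _ => ?_
      by_cases hAA : A = A'
      · simp [hAA]
      · obtain ⟨k, hk⟩ := not_forall.1 (fun h => hAA (Set.ext h))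
        filter_upwards [eventually_gt_atTop k] with n hn heq
        have := congr(k ∈ $heq)
        simp [hn] at this
        exact absurd this hk
    obtain ⟨n, hns, hn⟩ := (hxs.and hsep).exists
    refine ⟨x n, Set.mem_iInter₂.2 fun A hA => ?_, hns⟩
    by_cases hT : A ∈ T
    · simp only [B, hT, if_true, independentSet, x]
      exact Finset.mem_image.2 ⟨A, by simp [hA, hT], rfl⟩
    · simp only [B, hT, if_false]
      intro hmem
      obtain ⟨A', hA', hEq⟩ := Finset.mem_image.1 hmem
      simp only [Finset.mem_filter, Set.Finite.mem_toFinset] at hA'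
      refine hT ?_
      rw [hn A hA A' hA'.1 (hEq.symm.trans ?_)]
      · exact hA'.2
      · congr
  let e : X ≃ ℕ := Denumerable.eqv X
  refine ⟨fun T => (Ultrafilter.of (F T)).map e, ?_, ?_⟩
  · intro T S h
    have h' : Ultrafilter.of (F T) = Ultrafilter.of (F S) := by
      have := congrArg (Ultrafilter.map e.symm) h
      simpa [Ultrafilter.map_map] using this
    have hmem : ∀ T A, B T A ∈ Ultrafilter.of (F T) := fun T A =>
      Ultrafilter.of_le (F T) (mem_inf_of_left (mem_iInf_of_mem A (mem_principal_self _)))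
    ext A
    by_contra hA
    have h1 := hmem T A
    have h2 := hmem S A
    rw [← h'] at h2
    have h3 := inter_mem h1 h2
    have : B T A ∩ B S A = ∅ := by
      by_cases hT : A ∈ T <;> by_cases hS : A ∈ S <;> simp_all [B]
    rw [this] at h3
    exact empty_notMem _ h3
  · intro T
    rw [Ultrafilter.coe_map]
    refine (map_mono ((Ultrafilter.of_le (F T)).trans inf_le_right)).trans ?_
    exact e.injective.tendsto_cofinite

end Ultrafilters

section BlockAlgebra

variable (R : ℕ → Submodule ℂ H)

/-- The projection onto the closed span of the subspaces `R n` with `n ∈ A`. -/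
noncomputable def blockProj (A : Set ℕ) : H →L[ℂ] H :=
  (⨆ n : A, R n).topologicalClosure.starProjection

theorem isStarProjection_blockProj (A : Set ℕ) : IsStarProjection (blockProj R A) :=
  isStarProjection_starProjection

theorem blockProj_mem (N : VonNeumannAlgebra H)
    (hN : ∀ n, ∀ y ∈ N.commutant, ∀ v ∈ R n, y v ∈ R n) (A : Set ℕ) : blockProj R A ∈ N := by
  refine starProjection_closure_mem N _ fun y hy v hv => ?_
  have hle : (⨆ n : A, R n) ≤ (⨆ n : A, R n).comap (y : H →ₗ[ℂ] H) :=
    iSup_le fun n u hu => Submodule.mem_iSup_of_mem n (hN n y hy u hu)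
  exact hle hv

theorem tendsto_blockProj_Iio (v : H) :
    Tendsto (fun n : ℕ => blockProj R (Set.Iio n) v) atTop (𝓝 (blockProj R Set.univ v)) := by
  have hmono : Monotone fun n : ℕ => (⨆ k : Set.Iio n, R k).topologicalClosure := by
    intro m n hmn
    refine Submodule.topologicalClosure_mono (iSup_le fun k => ?_)
    exact le_iSup (fun k : Set.Iio n => R k) ⟨k, lt_of_lt_of_le k.2 hmn⟩
  have heq : (⨆ n : ℕ, (⨆ k : Set.Iio n, R k).topologicalClosure).topologicalClosure =
      (⨆ k : (Set.univ : Set ℕ), R k).topologicalClosure := by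
    apply le_antisymm
    · refine Submodule.topologicalClosure_minimal _ (iSup_le fun n => ?_)
        (Submodule.isClosed_topologicalClosure _)
      exact Submodule.topologicalClosure_mono (iSup_le fun k =>
        le_iSup (fun k : (Set.univ : Set ℕ) => R k) ⟨k, trivial⟩)
    · refine Submodule.topologicalClosure_mono (iSup_le fun k => ?_)
      refine le_trans ?_ (le_iSup _ (k.1 + 1))
      refine le_trans ?_ (Submodule.le_topologicalClosure _)
      exact le_iSup (fun j : Set.Iio (k.1 + 1) => R j) ⟨k.1, Nat.lt_succ_self _⟩
  have := Submodule.starProjection_tendsto_closure_iSup _ hmono v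
  simp only [heq] at this
  exact this

variable {R}

theorem blockProj_apply_of_mem {A : Set ℕ} {n : ℕ} (hn : n ∈ A) {u : H} (hu : u ∈ R n) :
    blockProj R A u = u :=
  Submodule.starProjection_eq_self_iff.2
    (Submodule.le_topologicalClosure _ (Submodule.mem_iSup_of_mem (⟨n, hn⟩ : A) hu))

theorem blockProj_apply_of_notMem (hR : ∀ m n, m ≠ n → R m ⟂ R n) {A : Set ℕ} {n : ℕ}
    (hn : n ∉ A) {u : H} (hu : u ∈ R n) : blockProj R A u = 0 := by
  refine (Submodule.starProjection_apply_eq_zero_iff _).2 ?_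
  rw [Submodule.orthogonal_closure, ← Submodule.iInf_orthogonal, Submodule.mem_iInf]
  exact fun k => (hR n k (fun h => hn (h ▸ k.2))) hu

theorem blockProj_mul_of_disjoint (hR : ∀ m n, m ≠ n → R m ⟂ R n) {A B : Set ℕ}
    (hAB : Disjoint A B) : blockProj R A * blockProj R B = 0 := by
  refine Submodule.IsOrtho.starProjection_comp_starProjection ?_
  rw [Submodule.isOrtho_iff_le, Submodule.orthogonal_closure]
  refine Submodule.topologicalClosure_minimal _ ?_ (Submodule.isClosed_orthogonal _)
  rw [← Submodule.isOrtho_iff_le, Submodule.isOrtho_iSup_left]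
  intro i
  rw [Submodule.isOrtho_iSup_right]
  exact fun j => hR i j fun h => Set.disjoint_left.1 hAB i.2 (h ▸ j.2)

/-- An operator acting on each block in `A` as a scalar of modulus at most `ε` has norm at most
`ε` on the closed span of these blocks. -/
theorem norm_mul_blockProj_le (hR : ∀ m n, m ≠ n → R m ⟂ R n) {A : Set ℕ} {Y : H →L[ℂ] H}
    {c : ℕ → ℂ} {ε : ℝ} (hε : 0 ≤ ε) (hc : ∀ n ∈ A, ‖c n‖ ≤ ε)
    (hY : ∀ n ∈ A, ∀ u ∈ R n, Y u = c n • u) : ‖Y * blockProj R A‖ ≤ ε := by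
  have hfam : OrthogonalFamily ℂ (fun n => R n) (fun n => (R n).subtypeₗᵢ) :=
    fun m n hmn u v => hR m n hmn |>.inner_eq u.2 v.2
  have halg : ∀ v ∈ (⨆ n : A, R n), ‖Y v‖ ≤ ε * ‖v‖ := by
    intro v hv
    obtain ⟨l, hl, rfl⟩ := (Submodule.mem_iSup_iff_exists_finsupp _ _).1 hv
    have hfamA := hfam.comp (Subtype.val_injective (p := (· ∈ A)))
    have hv2 : ‖∑ i ∈ l.support, l i‖ ^ 2 = ∑ i ∈ l.support, ‖l i‖ ^ 2 :=
      hfamA.norm_sum (fun i => ⟨l i, hl i⟩) l.support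
    have hYv2 : ‖∑ i ∈ l.support, c i • l i‖ ^ 2 = ∑ i ∈ l.support, ‖c i • l i‖ ^ 2 :=
      hfamA.norm_sum (fun i => c i • ⟨l i, hl i⟩) l.support
    have hYv : Y (l.sum fun _ x => x) = ∑ i ∈ l.support, c i • l i := by
      rw [Finsupp.sum, map_sum]
      exact Finset.sum_congr rfl fun i _ => hY i i.2 _ (hl i)
    refine abs_le_of_sq_le_sq' ?_ (by positivity) |>.2
    rw [hYv, Finsupp.sum, mul_pow, hv2, hYv2, Finset.mul_sum]
    refine Finset.sum_le_sum fun i _ => ?_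
    rw [norm_smul, mul_pow]
    gcongr
    exact hc i i.2
  have hclos : ∀ v ∈ (⨆ n : A, R n).topologicalClosure, ‖Y v‖ ≤ ε * ‖v‖ := by
    intro v hv
    exact closure_minimal (s := ((⨆ n : A, R n : Submodule ℂ H) : Set H))
      (t := {v | ‖Y v‖ ≤ ε * ‖v‖}) halg
      (isClosed_le (by fun_prop) (by fun_prop)) hv
  refine ContinuousLinearMap.opNorm_le_bound _ hε fun v => ?_
  refine (hclos _ (Submodule.starProjection_apply_mem _ v)).trans ?_
  gcongr
  exact Submodule.norm_starProjection_apply_le _ v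

variable (R) in
/-- The von Neumann algebra generated by the block projections. -/
noncomputable def blockAlgebra : VonNeumannAlgebra H where
  toStarSubalgebra := StarSubalgebra.centralizer ℂ (Set.centralizer (Set.range (blockProj R)))
  centralizer_centralizer' := by
    simp

theorem mem_blockAlgebra {x : H →L[ℂ] H} :
    x ∈ blockAlgebra R ↔ ∀ g : H →L[ℂ] H,
      (∀ A, blockProj R A * g = g * blockProj R A) → g * x = x * g := by
  change x ∈ StarSubalgebra.centralizer ℂ (Set.centralizer (Set.range (blockProj R))) ↔ _
  rw [StarSubalgebra.mem_centralizer_iff]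
  simp only [Set.mem_centralizer_iff, Set.forall_mem_range]
  refine ⟨fun h g hg => (h g hg).1, fun h g hg => ⟨h g hg, h _ fun A => ?_⟩⟩
  simpa [(isStarProjection_blockProj R A).isSelfAdjoint.star_eq] using congr(star $(hg A)).symm

theorem blockProj_mem_blockAlgebra (A : Set ℕ) : blockProj R A ∈ blockAlgebra R :=
  mem_blockAlgebra.2 fun _ hg => (hg A).symm

theorem blockAlgebra_subset (N : VonNeumannAlgebra H)
    (hN : ∀ n, ∀ y ∈ N.commutant, ∀ v ∈ R n, y v ∈ R n) :
    (blockAlgebra R : Set (H →L[ℂ] H)) ⊆ N := by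
  intro x hx
  rw [← N.commutant_commutant, SetLike.mem_coe, VonNeumannAlgebra.mem_commutant_iff]
  exact fun g hg => mem_blockAlgebra.1 hx g fun A =>
    VonNeumannAlgebra.mem_commutant_iff.1 hg _ (blockProj_mem R N hN A)

/-- Elements of the block algebra act on each block as a scalar. -/
theorem blockAlgebra_apply (hR : ∀ m n, m ≠ n → R m ⟂ R n) {x : H →L[ℂ] H}
    (hx : x ∈ blockAlgebra R) {n : ℕ} {w u : H} (hw : w ∈ R n) (hw1 : ‖w‖ = 1) (hu : u ∈ R n) :
    x u = ⟪w, x w⟫_ℂ • u := by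
  have hcomm := mem_blockAlgebra.1 hx (InnerProductSpace.rankOne ℂ u w) fun A => ?_
  · have := congr($hcomm w)
    simpa [hw1] using this.symm
  · ext v
    have hsymm : ⟪w, blockProj R A v⟫_ℂ = ⟪blockProj R A w, v⟫_ℂ :=
      (Submodule.inner_starProjection_left_eq_right _ _ _).symm
    simp only [mul_apply_eq_comp, InnerProductSpace.rankOne_apply, map_smul, hsymm]
    by_cases hn : n ∈ A
    · rw [blockProj_apply_of_mem hn hu, blockProj_apply_of_mem hn hw]
    · rw [blockProj_apply_of_notMem hR hn hu, blockProj_apply_of_notMem hR hn hw]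
      simp

end BlockAlgebra

section PureStates

theorem IsPosFunctional.map_eq_zero_of_le {M : VonNeumannAlgebra H} {f g : ↥M →ₗ[ℂ] ℂ}
    (hg : IsPosFunctional M g) (hfg : IsPosFunctional M (f - g)) {a : ↥M}
    (ha : f (star a * a) = 0) : g (star a * a) = 0 := by
  have h2 := hfg a
  rw [LinearMap.sub_apply, ha, zero_sub, neg_nonneg] at h2
  exact le_antisymm h2 (hg a)

theorem IsPosFunctional.smul {M : VonNeumannAlgebra H} {f : ↥M →ₗ[ℂ] ℂ}
    (hf : IsPosFunctional M f) {t : ℂ} (ht : 0 ≤ t) : IsPosFunctional M (t • f) :=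
  fun a => mul_nonneg ht (hf a)

/-- If some state is `1` on a set of projections, then so is some pure state. -/
theorem exists_isPureStateOn (M : VonNeumannAlgebra H) (Q : Set ↥M)
    (hQ : ∀ q ∈ Q, IsStarProjection q) (hne : ∃ f, IsStateOn M f ∧ ∀ q ∈ Q, f q = 1) :
    ∃ f, IsPureStateOn M f ∧ ∀ q ∈ Q, f q = 1 := by
  let F : Set (↥M → ℂ) := {φ | ∃ f : ↥M →ₗ[ℂ] ℂ, (IsStateOn M f ∧ ∀ q ∈ Q, f q = 1) ∧ ⇑f = φ}
  have hFeq : F = (⋂ a, ⋂ b, {φ | φ (a + b) = φ a + φ b}) ∩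
      (⋂ c : ℂ, ⋂ a, {φ | φ (c • a) = c * φ a}) ∩ (⋂ a, {φ | 0 ≤ φ (star a * a)}) ∩
      {φ | φ 1 = 1} ∩ ⋂ q ∈ Q, {φ | φ q = 1} := by
    ext φ
    simp only [Set.mem_inter_iff, Set.mem_iInter]
    constructor
    · rintro ⟨f, ⟨⟨hpos, h1⟩, hq⟩, rfl⟩
      exact ⟨⟨⟨⟨map_add f, map_smul f⟩, hpos⟩, h1⟩, hq⟩
    · rintro ⟨⟨⟨⟨hadd, hsmul⟩, hpos⟩, h1⟩, hq⟩
      exact ⟨{ toFun := φ, map_add' := hadd, map_smul' := hsmul }, ⟨⟨hpos, h1⟩, hq⟩, rfl⟩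
  have hclosed : IsClosed F := by
    rw [hFeq]
    refine ((((isClosed_iInter fun a => isClosed_iInter fun b => ?_).inter
      (isClosed_iInter fun c => isClosed_iInter fun a => ?_)).inter
      (isClosed_iInter fun a => ?_)).inter ?_).inter
      (isClosed_iInter fun q => isClosed_iInter fun _ => ?_)
    · exact isClosed_eq (by fun_prop) (by fun_prop)
    · exact isClosed_eq (by fun_prop) (by fun_prop)
    · exact isClosed_le (by fun_prop) (by fun_prop)
    · exact isClosed_eq (by fun_prop) (by fun_prop)
    · exact isClosed_eq (by fun_prop) (by fun_prop)
  have hcompact : IsCompact F := by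
    refine (isCompact_univ_pi fun a : ↥M =>
      isCompact_closedBall (0 : ℂ) ‖(a : H →L[ℂ] H)‖).of_isClosed_subset hclosed ?_
    rintro _ ⟨f, ⟨hf, -⟩, rfl⟩ a -
    simpa using hf.norm_apply_le a
  have hFne : F.Nonempty := by
    obtain ⟨f, hf⟩ := hne
    exact ⟨f, f, hf, rfl⟩
  obtain ⟨φ, hφ⟩ := hcompact.extremePoints_nonempty (E := ↥M → ℂ) hFne
  obtain ⟨⟨f, ⟨⟨hpos, h1⟩, hq⟩, rfl⟩, hext⟩ := mem_extremePoints.1 hφ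
  have hface : ∀ (g : ↥M →ₗ[ℂ] ℂ) (t : ℝ), 0 < t → IsPosFunctional M g →
      IsPosFunctional M (f - g) → g 1 = t → ⇑((t : ℂ)⁻¹ • g) ∈ F := by
    intro g t ht hg hfg hg1
    have ht0 : (t : ℂ) ≠ 0 := by exact_mod_cast ht.ne'
    refine ⟨_, ⟨⟨hg.smul (by positivity), ?_⟩, ?_⟩, rfl⟩
    · simp [hg1, ht0]
    · intro q hqQ
      have hq' : IsStarProjection (1 - q) := (hQ q hqQ).one_sub
      have hsq : star (1 - q) * (1 - q) = 1 - q := by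
        rw [hq'.isSelfAdjoint.star_eq, hq'.isIdempotentElem.eq]
      have := hg.map_eq_zero_of_le hfg (a := 1 - q) (by rw [hsq, map_sub, h1, hq q hqQ, sub_self])
      rw [hsq, map_sub, sub_eq_zero] at this
      simp [← this, hg1, ht0]
  refine ⟨f, ⟨⟨hpos, h1⟩, fun g hg hfg => ?_⟩, hq⟩
  have hg1 : 0 ≤ g 1 := by simpa using hg 1
  have hfg1 : 0 ≤ 1 - g 1 := by simpa [h1] using hfg 1
  obtain ⟨t, ht⟩ : ∃ t : ℝ, g 1 = t := ⟨(g 1).re, Complex.eq_re_of_ofReal_le hg1⟩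
  rw [ht] at hg1 hfg1
  have ht0 : 0 ≤ t := by exact_mod_cast hg1
  have ht1 : t ≤ 1 := by
    have : (0 : ℂ) ≤ ((1 - t : ℝ) : ℂ) := by push_cast; exact hfg1
    have : 0 ≤ 1 - t := by exact_mod_cast this
    linarith
  refine ⟨t, ht0, ?_⟩
  rcases ht0.eq_or_lt with rfl | htpos
  · simpa using hg.eq_zero (by simpa using ht)
  rcases ht1.eq_or_lt with rfl | htlt
  · have := hfg.eq_zero (by simp [h1, ht])
    rw [sub_eq_zero] at this
    simp [this]
  have hs0 : (t : ℂ) ≠ 0 := by exact_mod_cast htpos.ne'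
  have hs1 : ((1 - t : ℝ) : ℂ) ≠ 0 := by exact_mod_cast (sub_pos.2 htlt).ne'
  have hA := hface g t htpos hg hfg ht
  have hB := hface (f - g) (1 - t) (sub_pos.2 htlt) hfg (by simpa using hg) (by simp [h1, ht])
  have hseg : (⇑f : ↥M → ℂ) ∈ openSegment ℝ ⇑((t : ℂ)⁻¹ • g) ⇑(((1 - t : ℝ) : ℂ)⁻¹ • (f - g)) := by
    refine ⟨t, 1 - t, htpos, sub_pos.2 htlt, by ring, ?_⟩
    funext a
    simp only [Pi.add_apply, Pi.smul_apply, LinearMap.smul_apply, LinearMap.sub_apply,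
      Complex.real_smul, smul_eq_mul, mul_inv_cancel_left₀ hs0, mul_inv_cancel_left₀ hs1]
    ring
  have heq := (hext _ hA _ hB hseg).1
  ext a
  have := congrFun heq a
  simp only [LinearMap.smul_apply, smul_eq_mul] at this ⊢
  rw [← this, mul_inv_cancel_left₀ hs0]

theorem exists_tendsto_inner {w : ℕ → H} (hw1 : ∀ n, ‖w n‖ = 1) (U : Ultrafilter ℕ)
    (a : H →L[ℂ] H) : ∃ z, Tendsto (fun n => ⟪w n, a (w n)⟫_ℂ) U (𝓝 z) := by
  have hmem : Metric.closedBall (0 : ℂ) ‖a‖ ∈ U.map fun n => ⟪w n, a (w n)⟫_ℂ := by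
    refine Ultrafilter.mem_map.2 (Filter.univ_mem' fun n => ?_)
    simp only [Set.mem_preimage, mem_closedBall_zero_iff]
    calc ‖⟪w n, a (w n)⟫_ℂ‖ ≤ ‖w n‖ * ‖a (w n)‖ := norm_inner_le_norm _ _
      _ ≤ ‖w n‖ * (‖a‖ * ‖w n‖) := by gcongr; exact a.le_opNorm _
      _ = ‖a‖ := by simp [hw1]
  obtain ⟨z, -, hz⟩ := (isCompact_closedBall (0 : ℂ) ‖a‖).ultrafilter_le_nhds' _ hmem
  exact ⟨z, hz⟩

/-- The state `a ↦ lim ⟪w n, a (w n)⟫` along an ultrafilter. -/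
theorem exists_limit_state (N : VonNeumannAlgebra H) {w : ℕ → H} (hw1 : ∀ n, ‖w n‖ = 1)
    (U : Ultrafilter ℕ) : ∃ f : ↥N →ₗ[ℂ] ℂ, IsStateOn N f ∧
      ∀ a : ↥N, Tendsto (fun n => ⟪w n, (a : H →L[ℂ] H) (w n)⟫_ℂ) U (𝓝 (f a)) := by
  choose L hL using fun a : ↥N => exists_tendsto_inner hw1 U (a : H →L[ℂ] H)
  refine ⟨{ toFun := L, map_add' := fun a b => ?_, map_smul' := fun c a => ?_ }, ⟨?_, ?_⟩, hL⟩
  · refine tendsto_nhds_unique (hL (a + b)) (((hL a).add (hL b)).congr fun n => ?_)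
    simp
  · refine tendsto_nhds_unique (hL (c • a)) (((hL a).const_mul c).congr fun n => ?_)
    simp
  · intro a
    refine ge_of_tendsto' (hL (star a * a)) fun n => ?_
    have : ⟪w n, ((star a * a : ↥N) : H →L[ℂ] H) (w n)⟫_ℂ =
        ⟪(a : H →L[ℂ] H) (w n), (a : H →L[ℂ] H) (w n)⟫_ℂ := by
      change ⟪w n, (star (a : H →L[ℂ] H)) ((a : H →L[ℂ] H) (w n))⟫_ℂ = _
      rw [ContinuousLinearMap.star_eq_adjoint, ContinuousLinearMap.adjoint_inner_right]
    rw [this, inner_self_eq_norm_sq_to_K]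
    positivity
  · refine tendsto_nhds_unique (hL 1) (tendsto_const_nhds.congr fun n => ?_)
    simp [hw1]

end PureStates

section UltrafilterStates

variable {R : ℕ → Submodule ℂ H} {N : VonNeumannAlgebra H}

/-- A state concentrated along `U` is on the block algebra the limit along `U` of vector
states. -/
theorem tendsto_inner_of_mem_blockAlgebra (hR : ∀ m n, m ≠ n → R m ⟂ R n)
    (hN : ∀ n, ∀ y ∈ N.commutant, ∀ v ∈ R n, y v ∈ R n) {w : ℕ → H} (hw : ∀ n, w n ∈ R n)
    (hw1 : ∀ n, ‖w n‖ = 1) {U : Ultrafilter ℕ} {f : ↥N →ₗ[ℂ] ℂ} (hf : IsStateOn N f)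
    (hfU : ∀ A ∈ U, f ⟨blockProj R A, blockProj_mem R N hN A⟩ = 1) (x : ↥N)
    (hx : (x : H →L[ℂ] H) ∈ blockAlgebra R) :
    Tendsto (fun n => ⟪w n, (x : H →L[ℂ] H) (w n)⟫_ℂ) U (𝓝 (f x)) := by
  obtain ⟨L, hL⟩ := exists_tendsto_inner hw1 U (x : H →L[ℂ] H)
  suffices h : f x = L by rwa [h]
  refine eq_of_forall_dist_le fun ε hε => ?_
  let A : Set ℕ := {n | dist ⟪w n, (x : H →L[ℂ] H) (w n)⟫_ℂ L ≤ ε}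
  have hA : A ∈ U := (hL.eventually (Metric.closedBall_mem_nhds L hε))
  let p : ↥N := ⟨blockProj R A, blockProj_mem R N hN A⟩
  have hp : IsStarProjection (1 - (p : H →L[ℂ] H)) := (isStarProjection_blockProj R A).one_sub
  have hp0 : f (star (1 - p) * (1 - p)) = 0 := by
    have : star (1 - p) * (1 - p) = 1 - p := Subtype.ext <| by
      change star (1 - (p : H →L[ℂ] H)) * (1 - p) = 1 - p
      rw [hp.isSelfAdjoint.star_eq, hp.isIdempotentElem.eq]
    rw [this, map_sub, hf.2, hfU A hA, sub_self]
  let y : ↥N := x - L • 1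
  have hy : f x - L = f (y * p) := by
    have h1 : f y = f (y * p) + f (y * (1 - p)) := by rw [← map_add]; congr 1; noncomm_ring
    rw [hf.1.map_mul_eq_zero hp0 y, add_zero] at h1
    rw [← h1, map_sub, map_smul, hf.2, smul_eq_mul, mul_one]
  rw [dist_eq_norm, hy]
  refine (hf.norm_apply_le _).trans ?_
  refine norm_mul_blockProj_le hR (c := fun n => ⟪w n, (x : H →L[ℂ] H) (w n)⟫_ℂ - L) hε.le
    (fun n hn => by rw [← dist_eq_norm]; exact hn) fun n _ u hu => ?_
  change (x : H →L[ℂ] H) u - L • u = _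
  rw [blockAlgebra_apply hR hx (hw n) (hw1 n) hu, sub_smul]

theorem map_blockProj_eq_zero (hR : ∀ m n, m ≠ n → R m ⟂ R n)
    (hN : ∀ n, ∀ y ∈ N.commutant, ∀ v ∈ R n, y v ∈ R n) {U : Ultrafilter ℕ}
    {f : ↥N →ₗ[ℂ] ℂ} (hf : IsStateOn N f)
    (hfU : ∀ A ∈ U, f ⟨blockProj R A, blockProj_mem R N hN A⟩ = 1) {A : Set ℕ} (hA : A ∉ U) :
    f ⟨blockProj R A, blockProj_mem R N hN A⟩ = 0 := by
  let p : ↥N := ⟨blockProj R A, blockProj_mem R N hN A⟩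
  let q : ↥N := ⟨blockProj R Aᶜ, blockProj_mem R N hN Aᶜ⟩
  have hq : IsStarProjection (1 - (q : H →L[ℂ] H)) := (isStarProjection_blockProj R Aᶜ).one_sub
  have hq0 : f (star (1 - q) * (1 - q)) = 0 := by
    have : star (1 - q) * (1 - q) = 1 - q := Subtype.ext <| by
      change star (1 - (q : H →L[ℂ] H)) * (1 - q) = 1 - q
      rw [hq.isSelfAdjoint.star_eq, hq.isIdempotentElem.eq]
    rw [this, map_sub, hf.2, hfU _ (Ultrafilter.compl_mem_iff_notMem.2 hA), sub_self]
  have hpq : p * (1 - q) = p := by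
    have : p * q = 0 := Subtype.ext (blockProj_mul_of_disjoint hR disjoint_compl_right)
    rw [mul_sub, mul_one, this, sub_zero]
  have := hf.1.map_mul_eq_zero hq0 p
  rwa [hpq] at this

/-- Bounded strong convergence of a sequence implies σ-weak convergence. -/
theorem tendsto_sigmaWeak {x : ℕ → H →L[ℂ] H} {y : H →L[ℂ] H} (hx : ∀ n, ‖x n‖ ≤ 1)
    (h : ∀ v, Tendsto (fun n => x n v) atTop (𝓝 (y v))) :
    Tendsto x atTop (@nhds _ (sigmaWeak H) y) := by
  rw [sigmaWeak, nhds_iInf, tendsto_iInf]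
  intro ξ
  rw [nhds_iInf, tendsto_iInf]
  intro η
  rw [nhds_iInf, tendsto_iInf]
  intro hξ
  rw [nhds_iInf, tendsto_iInf]
  intro hη
  rw [@nhds_induced _ _ inferInstance, tendsto_comap_iff]
  refine tendsto_tsum_of_dominated_convergence (bound := fun k => ‖ξ k‖ ^ 2 + ‖η k‖ ^ 2)
    (hξ.add hη) (fun k => ?_) (Eventually.of_forall fun n k => ?_)
  · exact tendsto_const_nhds.inner (h (η k))
  · have h1 : ‖x n (η k)‖ ≤ ‖η k‖ := by simpa using (x n).le_of_opNorm_le (hx n) (η k)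
    calc ‖⟪ξ k, x n (η k)⟫_ℂ‖ ≤ ‖ξ k‖ * ‖x n (η k)‖ := norm_inner_le_norm _ _
      _ ≤ ‖ξ k‖ * ‖η k‖ := by gcongr
      _ ≤ ‖ξ k‖ ^ 2 + ‖η k‖ ^ 2 := by nlinarith [sq_nonneg (‖ξ k‖ - ‖η k‖)]

/-- A state concentrated along a free ultrafilter is not classically normal. -/
theorem not_isClassicallyNormalOn (hR : ∀ m n, m ≠ n → R m ⟂ R n)
    (hN : ∀ n, ∀ y ∈ N.commutant, ∀ v ∈ R n, y v ∈ R n) {w : ℕ → H} (hw : ∀ n, w n ∈ R n)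
    (hw1 : ∀ n, ‖w n‖ = 1) {U : Ultrafilter ℕ} (hU : (U : Filter ℕ) ≤ cofinite)
    {f : ↥N →ₗ[ℂ] ℂ} (hf : IsStateOn N f)
    (hfU : ∀ A ∈ U, f ⟨blockProj R A, blockProj_mem R N hN A⟩ = 1) :
    ¬ IsClassicallyNormalOn N f := by
  intro hcl
  have hlim := tendsto_inner_of_mem_blockAlgebra hR hN hw hw1 hf hfU
  have hnormal := hcl (blockAlgebra R) (blockAlgebra_subset N hN) fun a b ha hb => by
    refine tendsto_nhds_unique (hlim (a * b) (mul_mem ha hb))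
      (((hlim a ha).mul (hlim b hb)).congr fun n => ?_)
    change _ = ⟪w n, (a : H →L[ℂ] H) ((b : H →L[ℂ] H) (w n))⟫_ℂ
    rw [blockAlgebra_apply hR hb (hw n) (hw1 n) (hw n), map_smul, inner_smul_right, mul_comm,
      inner_smul_right, inner_self_eq_norm_sq_to_K, hw1]
    simp
  let q : Set ℕ → ↥(blockAlgebra R) := fun A => ⟨blockProj R A, blockProj_mem_blockAlgebra A⟩
  have hq : Tendsto (fun n : ℕ => q (Set.Iio n)) atTop (@nhds _ (TopologicalSpace.induced
      (fun x : ↥(blockAlgebra R) => (x : H →L[ℂ] H)) (sigmaWeak H)) (q Set.univ)) := by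
    rw [@nhds_induced _ _ (sigmaWeak H), tendsto_comap_iff]
    exact tendsto_sigmaWeak (fun n => Submodule.starProjection_norm_le _)
      (tendsto_blockProj_Iio R)
  have hlim1 := (@Continuous.tendsto _ _ (TopologicalSpace.induced
      (fun x : ↥(blockAlgebra R) => (x : H →L[ℂ] H)) (sigmaWeak H)) _ _ hnormal
        (q Set.univ)).comp hq
  have hzero : ∀ n : ℕ, f ⟨blockProj R (Set.Iio n), blockProj_mem R N hN _⟩ = 0 := fun n =>
    map_blockProj_eq_zero hR hN hf hfU fun hmem =>
      Ultrafilter.compl_notMem_iff.2 hmem (hU (by simp))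
  have h0 : Tendsto (fun _ : ℕ => (0 : ℂ)) atTop (𝓝 1) := by
    rw [← hfU Set.univ Filter.univ_mem]
    exact hlim1.congr hzero
  exact zero_ne_one (tendsto_nhds_unique tendsto_const_nhds h0)

end UltrafilterStates

/-- Assuming the continuum hypothesis, every infinite-dimensional factor acting on a
separable Hilbert space admits `2 ^ ℵ₁` distinct pure states that are not classically
normal. -/
theorem card_not_classically_normal_pure_states
    (CH : (2 : Cardinal.{0}) ^ Cardinal.aleph0 = Cardinal.aleph 1)
    {H : Type} [NormedAddCommGroup H] [InnerProductSpace ℂ H] [CompleteSpace H]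
    [TopologicalSpace.SeparableSpace H]
    (N : VonNeumannAlgebra H) (hfac : IsFactor N) (hinf : ¬ FiniteDimensional ℂ ↥N) :
    ∃ S : Set (↥N →ₗ[ℂ] ℂ),
      Cardinal.mk ↥S = 2 ^ Cardinal.aleph 1 ∧
      ∀ f ∈ S, IsPureStateOn N f ∧ ¬ IsClassicallyNormalOn N f := by
  obtain ⟨T, hT, hTT⟩ := exists_orthogonal_seq N hinf
  let R : ℕ → Submodule ℂ H := fun n => LinearMap.range (T n : H →ₗ[ℂ] H)
  have hR : ∀ m n, m ≠ n → R m ⟂ R n := by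
    intro m n hmn
    rw [Submodule.isOrtho_iff_inner_eq]
    rintro _ ⟨u, rfl⟩ _ ⟨v, rfl⟩
    have h0 : ContinuousLinearMap.adjoint (T m) (T n v) = 0 := congr($(hTT m n hmn) v)
    have h1 := ContinuousLinearMap.adjoint_inner_right (T m) u (T n v)
    rw [h0, inner_zero_right] at h1
    exact h1.symm
  have hN : ∀ n, ∀ y ∈ N.commutant, ∀ v ∈ R n, y v ∈ R n := by
    rintro n y hy _ ⟨v, rfl⟩
    exact ⟨y v, congr($(VonNeumannAlgebra.mem_commutant_iff.1 hy _ (hT n).1) v)⟩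
  have hex : ∀ n, ∃ w ∈ R n, ‖w‖ = 1 := by
    intro n
    obtain ⟨v, hv⟩ : ∃ v, T n v ≠ 0 := by
      by_contra! h
      exact (hT n).2 (ContinuousLinearMap.ext h)
    exact ⟨((‖T n v‖⁻¹ : ℝ) : ℂ) • T n v, (R n).smul_mem _ ⟨v, rfl⟩, by
      rw [norm_smul, Complex.norm_real, norm_inv, norm_norm,
        inv_mul_cancel₀ (norm_ne_zero_iff.2 hv)]⟩
  choose w hw hw1 using hex
  let p : Set ℕ → ↥N := fun A => ⟨blockProj R A, blockProj_mem R N hN A⟩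
  have hpure : ∀ U : Ultrafilter ℕ, ∃ f, IsPureStateOn N f ∧ ∀ A ∈ U, f (p A) = 1 := by
    intro U
    have hQ : ∀ q ∈ p '' {A | A ∈ U}, IsStarProjection q := by
      rintro _ ⟨A, -, rfl⟩
      have := isStarProjection_blockProj R A
      exact ⟨Subtype.ext this.isIdempotentElem, Subtype.ext this.isSelfAdjoint⟩
    have hne : ∃ f, IsStateOn N f ∧ ∀ q ∈ p '' {A | A ∈ U}, f q = 1 := by
      obtain ⟨f, hf, hlim⟩ := exists_limit_state N hw1 U
      refine ⟨f, hf, ?_⟩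
      rintro _ ⟨A, hA, rfl⟩
      refine tendsto_nhds_unique (hlim (p A)) (tendsto_const_nhds.congr' ?_)
      filter_upwards [show A ∈ (U : Filter ℕ) from hA] with n hn
      change 1 = ⟪w n, blockProj R A (w n)⟫_ℂ
      rw [blockProj_apply_of_mem hn (hw n), inner_self_eq_norm_sq_to_K, hw1]
      simp
    obtain ⟨f, hf, hfQ⟩ := exists_isPureStateOn N _ hQ hne
    exact ⟨f, hf, fun A hA => hfQ _ ⟨A, hA, rfl⟩⟩
  choose F hF hFU using hpure
  obtain ⟨U, hUinj, hU⟩ := exists_injective_free_ultrafilters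
  have hFinj : Function.Injective F := by
    intro V W hVW
    refine Ultrafilter.coe_injective (Filter.ext fun A => ?_)
    have hiff : ∀ V : Ultrafilter ℕ, A ∈ V ↔ F V (p A) = 1 := fun V =>
      ⟨hFU V A, fun h => by
        by_contra hA
        rw [map_blockProj_eq_zero hR hN (hF V).1 (hFU V) hA] at h
        exact zero_ne_one h⟩
    exact (hiff V).trans (hVW ▸ (hiff W).symm)
  refine ⟨Set.range (F ∘ U), ?_, ?_⟩
  · rw [Cardinal.mk_range_eq _ (hFinj.comp hUinj), Cardinal.mk_set, Cardinal.mk_set,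
      Cardinal.mk_nat, CH]
  · rintro _ ⟨S, rfl⟩
    exact ⟨hF _, not_isClassicallyNormalOn hR hN hw hw1 (hU S) (hF _).1 (hFU _)⟩
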